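/- If isBST t holds and subtree t p = some s for a position p, then Map t = MapExcept t p † Map s (as functions ℤ → Option ℤ): the map of the whole tree decomposes as the map of the entries outside the subtree at p, overridden by the map of that subtree. -/

import Mathlib

namespace ScopeLogicBST

/-- Binary trees whose nodes carry an integer key and integer data. -/
inductive T : Type where
  | leaf : T
  | node : T → T → ℤ → ℤ → T

/-- The key set of a tree. -/
def Dom : T → Finset ℤ
  | .leaf => ∅
  | .node l r K _ => {K} ∪ Dom l ∪ Dom r

/-- The finite map defined only at `K`, with value `D`. -/
def single (K D : ℤ) : ℤ → Option ℤ := fun k => if k = K then some D else none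

/-- Right-biased override of finite maps. -/
def ovr (M M' : ℤ → Option ℤ) : ℤ → Option ℤ := fun k =>
  match M' k with
  | some v => some v
  | none => M k

infixl:65 " † " => ovr

/-- The finite map retrieved from a tree. -/
def Map : T → ℤ → Option ℤ
  | .leaf => fun _ => none
  | .node l r K D => (single K D † Map l) † Map r

/-- Binary-search-tree property. -/
def isBST : T → Prop
  | .leaf => True
  | .node l r K _ =>
      isBST l ∧ isBST r ∧ (∀ k ∈ Dom l, k < K) ∧ (∀ k ∈ Dom r, K < k)

end ScopeLogicBST

namespace ScopeLogicBST

/-- Directions into a binary tree. -/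
inductive Dir : Type where
  | L : Dir
  | R : Dir

/-- The subtree of a tree at a given position, if any. -/
def subtree : T → List Dir → Option T
  | t, [] => some t
  | .leaf, _ :: _ => none
  | .node l _ _ _, .L :: p => subtree l p
  | .node _ r _ _, .R :: p => subtree r p

end ScopeLogicBST

namespace ScopeLogicBST

/-- The map of all entries of `t` outside the subtree at position `p`. -/
def MapExcept : T → List Dir → ℤ → Option ℤ
  | _, [] => fun _ => none
  | .leaf, _ :: _ => fun _ => none
  | .node l r K D, .L :: p => (single K D † MapExcept l p) † Map r
  | .node l r K D, .R :: p => (single K D † Map l) † MapExcept r p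

end ScopeLogicBST

open ScopeLogicBST

namespace ScopeLogicBST

theorem ovr_apply (M M' : ℤ → Option ℤ) (k : ℤ) : (M † M') k = (M' k).or (M k) := by
  unfold ovr
  cases M' k <;> rfl

theorem ovr_assoc (M₁ M₂ M₃ : ℤ → Option ℤ) : M₁ † M₂ † M₃ = M₁ † (M₂ † M₃) := by
  funext k
  simp only [ovr_apply, Option.or_assoc]

theorem ovr_comm_of_disjoint {M M' : ℤ → Option ℤ} (h : ∀ k, M k = none ∨ M' k = none) :
    M † M' = M' † M := by
  funext k
  rcases h k with hk | hk <;> simp [ovr_apply, hk]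

theorem Map_eq_none_of_notMem_Dom {t : T} {k : ℤ} (hk : k ∉ Dom t) : Map t k = none := by
  induction t with
  | leaf => rfl
  | node l r K D ihl ihr =>
    simp only [Dom, Finset.mem_union, Finset.mem_singleton, not_or] at hk
    simp [Map, ovr_apply, single, ihl hk.1.2, ihr hk.2, hk.1.1]

theorem Dom_subset_of_subtree {t s : T} {p : List Dir} (h : subtree t p = some s) :
    Dom s ⊆ Dom t := by
  induction t generalizing p with
  | leaf =>
    cases p with
    | nil => cases h; rfl
    | cons d p => cases h
  | node l r K D ihl ihr =>
    cases p with
    | nil => cases h; rfl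
    | cons d p =>
      intro k hk
      simp only [Dom, Finset.mem_union]
      cases d with
      | L => exact .inl (.inr (ihl h hk))
      | R => exact .inr (ihr h hk)

theorem Map_ovr_comm_of_disjoint {t s : T} (h : Disjoint (Dom t) (Dom s)) :
    Map t † Map s = Map s † Map t := by
  refine ovr_comm_of_disjoint fun k => ?_
  by_cases hk : k ∈ Dom t
  · exact .inr (Map_eq_none_of_notMem_Dom (Finset.disjoint_left.mp h hk))
  · exact .inl (Map_eq_none_of_notMem_Dom hk)

end ScopeLogicBST

theorem map_decompose_at_subtree (t s : T) (p : List Dir)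
    (hbst : isBST t) (hp : subtree t p = some s) :
    Map t = MapExcept t p † Map s := by
  induction t generalizing p with
  | leaf =>
    cases p with
    | nil => cases hp; rfl
    | cons d p => cases hp
  | node l r K D ihl ihr =>
    obtain ⟨hl, hr, hlK, hKr⟩ := hbst
    cases p with
    | nil =>
      cases hp
      funext k
      simp [MapExcept, ovr_apply]
    | cons d p =>
      cases d with
      | L =>
        have hdisj : Disjoint (Dom s) (Dom r) := Finset.disjoint_left.mpr fun k hks hkr =>
          lt_asymm (hlK k (Dom_subset_of_subtree (p := p) hp hks)) (hKr k hkr)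
        simp only [Map, MapExcept, ihl p hl hp, ovr_assoc, Map_ovr_comm_of_disjoint hdisj]
      | R => simp only [Map, MapExcept, ihr p hr hp, ovr_assoc]
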